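/- arXiv:1105.4891 — 4 statements merged into one kernel-verified Lean document; each statement's English description precedes it below -/
import Mathlib

section
/- Let r be a real number, let x > 1 be real, and let m ≥ 0. Then the m-th derivative at x of the function t ↦ (log t)^r (real power) equals Σ_{j=0}^{m} j! · C(r,j) · (−1)^{m−j} · (Σ_{0 ≤ t_1 < t_2 < ⋯ < t_{m−j} < m} t_1 t_2 ⋯ t_{m−j}) · x^{−m} · (log x)^{r−j}, where C(r,j) = (∏_{i=0}^{j−1}(r−i))/j! is the generalized binomial coefficient and the inner sum is over all strictly increasing (m−j)-tuples of integers in {0,…,m−1} (an empty product being 1). -/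
open Finset in
/-- Pascal-type recurrence for the elementary symmetric sums of `f 0, …, f (m - 1)`. -/
theorem sum_powersetCard_range_succ {R : Type*} [CommSemiring R] (f : ℕ → R) (m k : ℕ) :
    ∑ T ∈ (range (m + 1)).powersetCard (k + 1), ∏ t ∈ T, f t =
      ∑ T ∈ (range m).powersetCard (k + 1), ∏ t ∈ T, f t +
        f m * ∑ T ∈ (range m).powersetCard k, ∏ t ∈ T, f t := by
  have notMem {T : Finset ℕ} {l : ℕ} (hT : T ∈ (range m).powersetCard l) : m ∉ T :=
    fun h => notMem_range_self ((mem_powersetCard.1 hT).1 h)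
  rw [range_add_one, powersetCard_succ_insert notMem_range_self, sum_union, sum_image, mul_sum]
  · congr 1
    exact sum_congr rfl fun T hT => prod_insert (notMem hT)
  · intro S hS T hT h
    rw [← erase_insert (notMem hS), h, erase_insert (notMem hT)]
  · refine disjoint_left.2 fun T hT hT' => ?_
    obtain ⟨S, -, rfl⟩ := mem_image.1 hT'
    exact notMem hT (mem_insert_self m S)

open Finset in
/-- The signed elementary symmetric sums of `f 0, …, f m` are the coefficients of the product of
`X - f m` with the polynomial whose coefficients are those of `f 0, …, f (m - 1)`; here the monomial
`X ^ j` is replaced by an arbitrary value `g j`. -/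
theorem sum_signed_powersetCard_range_succ {R : Type*} [CommRing R] (f g : ℕ → R) (m : ℕ) :
    ∑ j ∈ range (m + 2),
        (-1) ^ (m + 1 - j) * (∑ T ∈ (range (m + 1)).powersetCard (m + 1 - j), ∏ t ∈ T, f t) * g j =
      ∑ j ∈ range (m + 1),
        (-1) ^ (m - j) * (∑ T ∈ (range m).powersetCard (m - j), ∏ t ∈ T, f t) *
          (g (j + 1) - f m * g j) := by
  set e : ℕ → ℕ → R := fun n k => ∑ T ∈ (range n).powersetCard k, ∏ t ∈ T, f t with he
  have e_zero : e m 0 = 1 := by simp [he]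
  have e_self : e m (m + 1) = 0 := by simp [he, powersetCard_eq_empty.2]
  have e_succ (k : ℕ) : e (m + 1) (k + 1) = e m (k + 1) + f m * e m k :=
    sum_powersetCard_range_succ f m k
  have shift : ∑ k ∈ range (m + 1), (-1) ^ (k + 1) * e m (k + 1) * g (m - k) + g (m + 1) =
      ∑ k ∈ range (m + 1), (-1) ^ k * e m k * g (m - k + 1) := by
    rw [sum_range_succ, sum_range_succ', e_self, e_zero]
    simp only [mul_zero, zero_mul, add_zero, pow_zero, one_mul, Nat.sub_zero]
    congr 1
    refine sum_congr rfl fun k hk => ?_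
    rw [show m - (k + 1) + 1 = m - k by have := mem_range.1 hk; lia]
  have left : ∀ k ∈ range (m + 1),
      (-1) ^ (m + 1 - (m - k)) * e (m + 1) (m + 1 - (m - k)) * g (m - k) =
        (-1) ^ (k + 1) * e m (k + 1) * g (m - k) - f m * ((-1) ^ k * e m k * g (m - k)) := by
    intro k hk
    rw [show m + 1 - (m - k) = k + 1 by have := mem_range.1 hk; lia, e_succ]
    ring
  have right : ∀ k ∈ range (m + 1),
      (-1) ^ (m - (m - k)) * e m (m - (m - k)) * (g (m - k + 1) - f m * g (m - k)) =
        (-1) ^ k * e m k * g (m - k + 1) - f m * ((-1) ^ k * e m k * g (m - k)) := by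
    intro k hk
    rw [Nat.sub_sub_self (mem_range_succ_iff.1 hk)]
    ring
  rw [sum_range_succ, ← sum_flip fun j => (-1) ^ (m + 1 - j) * e (m + 1) (m + 1 - j) * g j,
    ← sum_flip fun j => (-1) ^ (m - j) * e m (m - j) * (g (j + 1) - f m * g j),
    sum_congr rfl left, sum_congr rfl right, sum_sub_distrib, sum_sub_distrib, ← shift,
    Nat.sub_self, powersetCard_zero, sum_singleton, prod_empty]
  ring

/-- Each derivative of `t ^ (-m) * (log t) ^ s` lowers the power of `t` by one. -/
theorem hasDerivAt_rpow_neg_mul_log_rpow (s : ℝ) (m : ℕ) {x : ℝ} (hx : 1 < x) :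
    HasDerivAt (fun t : ℝ => t ^ (-(m : ℝ)) * Real.log t ^ s)
      (x ^ (-((m + 1 : ℕ) : ℝ)) * (s * Real.log x ^ (s - 1) - m * Real.log x ^ s)) x := by
  have hx0 : 0 < x := by linarith
  have hpow : x ^ (-(m : ℝ)) * x⁻¹ = x ^ (-((m + 1 : ℕ) : ℝ)) := by
    rw [← Real.rpow_neg_one, ← Real.rpow_add hx0]
    push_cast
    ring_nf
  have hpow' : x ^ (-(m : ℝ) - 1) = x ^ (-((m + 1 : ℕ) : ℝ)) := by
    push_cast
    ring_nf
  refine ((Real.hasDerivAt_rpow_const (p := -(m : ℝ)) (Or.inl hx0.ne')).fun_mul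
    ((Real.hasDerivAt_log hx0.ne').rpow_const (p := s)
      (Or.inl (Real.log_pos hx).ne'))).congr_deriv ?_
  rw [hpow', ← hpow]
  ring


/-- The `m`-th derivative of `t ↦ (log t)^r` (real power) at `x > 1`:
`(d/dx)^m (log x)^r = Σ_{j=0}^{m} j! C(r,j) (−1)^{m−j} ·
(Σ_{0 ≤ t₁ < ⋯ < t_{m−j} < m} t₁⋯t_{m−j}) · x^{−m} (log x)^{r−j}`,
where `C(r,j) = r(r−1)⋯(r−j+1)/j!` and the inner sum (the signless Stirling number
of the first kind) is encoded as a sum over subsets of `{0,…,m−1}` of size `m−j`. -/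
theorem iteratedDeriv_log_rpow (r : ℝ) (x : ℝ) (hx : 1 < x) (m : ℕ) :
    iteratedDeriv m (fun t : ℝ => Real.log t ^ r) x =
      ∑ j ∈ Finset.range (m + 1),
        (j.factorial : ℝ) * ((∏ i ∈ Finset.range j, (r - i)) / j.factorial) *
          (-1) ^ (m - j) *
          (∑ T ∈ (Finset.range m).powersetCard (m - j), ∏ t ∈ T, (t : ℝ)) *
          x ^ (-(m : ℝ)) * Real.log x ^ (r - j) := by
  have hfact (j : ℕ) : (j.factorial : ℝ) * ((∏ i ∈ Finset.range j, (r - i)) / j.factorial) =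
      ∏ i ∈ Finset.range j, (r - i) :=
    mul_div_cancel₀ _ (Nat.cast_ne_zero.2 j.factorial_ne_zero)
  simp only [hfact]
  induction m generalizing x with
  | zero => simp
  | succ m ih =>
    rw [iteratedDeriv_succ, Filter.EventuallyEq.deriv_eq
      (Filter.eventually_of_mem (Ioi_mem_nhds hx) fun y hy => ih y hy)]
    have hderiv := HasDerivAt.fun_sum (u := Finset.range (m + 1)) fun j _ =>
      (hasDerivAt_rpow_neg_mul_log_rpow (r - j) m hx).const_mul
        ((∏ i ∈ Finset.range j, (r - i)) * (-1) ^ (m - j) *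
          ∑ T ∈ (Finset.range m).powersetCard (m - j), ∏ t ∈ T, (t : ℝ))
    simp only [← mul_assoc] at hderiv
    rw [hderiv.deriv]
    have hrec := sum_signed_powersetCard_range_succ (fun t => (t : ℝ))
      (fun j => x ^ (-((m + 1 : ℕ) : ℝ)) *
        ((∏ i ∈ Finset.range j, (r - i)) * Real.log x ^ (r - j))) m
    refine Eq.trans (Finset.sum_congr rfl fun j _ => ?_)
      (hrec.symm.trans (Finset.sum_congr rfl fun j _ => ?_))
    · rw [Finset.prod_range_succ, show r - ((j + 1 : ℕ) : ℝ) = r - j - 1 by push_cast; ring]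
      ring
    · ring
end

section
/- Let N ≥ 1, let r be a real number, let m ≥ 0, and let x be a real number. Let exp^[i] denote the i-fold iterate of the real exponential. Then the m-th derivative at x of the function t ↦ (exp^[N] t)^r (real power) equals Σ r^{j_N} · (∏_{i=1}^{N−1} S(α_i, α_{i+1})) · (exp^[N] x)^r · ∏_{i=1}^{N−1} (exp^[i] x)^{α_{i+1}}, where the sum is over all N-tuples (j_1, …, j_N) of natural numbers with j_1 + ⋯ + j_N = m, and where α_i = j_i + j_{i+1} + ⋯ + j_N. -/
/-- The Stirling number of the second kind `S(m,n)`, given by the sum over weakly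
increasing `(m−n)`-tuples `0 ≤ i₁ ≤ ⋯ ≤ i_{m−n} ≤ n` of the products `i₁⋯i_{m−n}`
(encoded as monotone functions `Fin (m−n) → Fin (n+1)`), with `S(m,n) = 0` when
`n > m`. -/
def stirlingSecond (m n : ℕ) : ℕ :=
  if n ≤ m then
    ∑ g ∈ Finset.univ.filter
        (fun g : Fin (m - n) → Fin (n + 1) => ∀ i j, i ≤ j → g i ≤ g j),
      ∏ i, (g i : ℕ)
  else 0

/-- The complete homogeneous sum of degree `d` in `0, …, n`, over weakly increasing tuples. -/
def monotoneProdSum (d n : ℕ) : ℕ :=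
  ∑ g ∈ Finset.univ.filter (fun g : Fin d → Fin (n + 1) => ∀ i j, i ≤ j → g i ≤ g j),
    ∏ i, (g i : ℕ)

theorem monotoneProdSum_zero_left (n : ℕ) : monotoneProdSum 0 n = 1 := by
  simp [monotoneProdSum]

theorem monotoneProdSum_succ_zero (d : ℕ) : monotoneProdSum (d + 1) 0 = 0 := by
  simp [monotoneProdSum]

theorem monotoneProdSum_succ_succ (d n : ℕ) :
    monotoneProdSum (d + 1) (n + 1) =
      (n + 1) * monotoneProdSum d (n + 1) + monotoneProdSum (d + 1) n := by
  unfold monotoneProdSum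
  rw [← Finset.sum_filter_add_sum_filter_not _
    (fun g : Fin (d + 1) → Fin (n + 2) => g (Fin.last d) = Fin.last (n + 1)), Finset.mul_sum]
  congr 1
  · refine Finset.sum_bij' (fun g _ => Fin.init g)
      (fun g _ => Fin.snoc (α := fun _ => Fin (n + 2)) g (Fin.last (n + 1))) ?_ ?_ ?_ ?_ ?_
    · intro g hg
      simp only [Finset.mem_filter, Finset.mem_univ, true_and] at hg ⊢
      intro i j hij
      exact hg.1 _ _ (by simpa using hij)
    · intro g hg
      simp only [Finset.mem_filter, Finset.mem_univ, true_and] at hg ⊢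
      refine ⟨fun i j hij => ?_, by simp⟩
      induction j using Fin.lastCases with
      | last => simpa using Fin.le_last _
      | cast j =>
        induction i using Fin.lastCases with
        | last => exact absurd hij (by simp)
        | cast i => simpa using hg i j (by simpa using hij)
    · intro g hg
      simp only [Finset.mem_filter] at hg
      simp only [← hg.2, Fin.snoc_init_self]
    · intro g _
      simp
    · intro g hg
      simp only [Finset.mem_filter] at hg
      rw [Fin.prod_univ_castSucc, hg.2, mul_comm]
      simp [Fin.init]
  · symm
    refine Finset.sum_bij (fun g _ i => (g i).castSucc) ?_ ?_ ?_ ?_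
    · intro g hg
      simp only [Finset.mem_filter, Finset.mem_univ, true_and] at hg ⊢
      exact ⟨fun i j hij => by simpa using hg i j hij, Fin.castSucc_ne_last _⟩
    · intro g _ g' _ h
      funext i
      exact Fin.castSucc_injective _ (congrFun h i)
    · intro g hg
      simp only [Finset.mem_filter, Finset.mem_univ, true_and] at hg
      have hne : ∀ i, g i ≠ Fin.last (n + 1) := fun i hi =>
        hg.2 (le_antisymm (Fin.le_last _) (hi ▸ hg.1 i _ (Fin.le_last i)))
      refine ⟨fun i => (g i).castPred (hne i), ?_, by simp⟩
      simp only [Finset.mem_filter, Finset.mem_univ, true_and]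
      intro i j hij
      simpa using hg.1 i j hij
    · intro g _
      simp

theorem monotoneProdSum_eq_stirlingSecond (d n : ℕ) :
    monotoneProdSum d n = Nat.stirlingSecond (n + d) n := by
  induction n generalizing d with
  | zero =>
    cases d with
    | zero => simp [monotoneProdSum_zero_left]
    | succ d => simp [monotoneProdSum_succ_zero, Nat.stirlingSecond_succ_zero]
  | succ n ihn =>
    induction d with
    | zero => simp [monotoneProdSum_zero_left, Nat.stirlingSecond_self]
    | succ d ihd =>
      rw [monotoneProdSum_succ_succ, ihd, ihn, ← add_assoc (n + 1) d 1,
        Nat.stirlingSecond_succ_succ, show n + 1 + d = n + (d + 1) by omega]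

theorem stirlingSecond_eq_natStirlingSecond (m n : ℕ) :
    stirlingSecond m n = Nat.stirlingSecond m n := by
  unfold stirlingSecond
  split_ifs with h
  · have := monotoneProdSum_eq_stirlingSecond (m - n) n
    rwa [Nat.add_sub_cancel' h] at this
  · exact (Nat.stirlingSecond_eq_zero_of_lt (not_le.1 h)).symm

open scoped ContDiff in
theorem iteratedDeriv_comp_exp {g : ℝ → ℝ} (hg : ContDiff ℝ ∞ g) (m : ℕ) (x : ℝ) :
    iteratedDeriv m (fun t => g (Real.exp t)) x =
      ∑ k ∈ Finset.range (m + 1),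
        (Nat.stirlingSecond m k : ℝ) * Real.exp x ^ k * iteratedDeriv k g (Real.exp x) := by
  induction m generalizing x with
  | zero => simp
  | succ m ih =>
    have hterm (k : ℕ) : HasDerivAt
        (fun t => (Nat.stirlingSecond m k : ℝ) * Real.exp t ^ k * iteratedDeriv k g (Real.exp t))
        (k * Nat.stirlingSecond m k * Real.exp x ^ k * iteratedDeriv k g (Real.exp x) +
          Nat.stirlingSecond m k * Real.exp x ^ (k + 1) * iteratedDeriv (k + 1) g (Real.exp x))
        x := by
      have hgk : HasDerivAt (iteratedDeriv k g) (iteratedDeriv (k + 1) g (Real.exp x))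
          (Real.exp x) := by
        rw [iteratedDeriv_succ]
        exact (hg.differentiable_iteratedDeriv k (by exact_mod_cast ENat.natCast_lt_top k)
          _).hasDerivAt
      have hpow : HasDerivAt (fun t => Real.exp t ^ k) (k * Real.exp x ^ k) x := by
        simpa [← Real.exp_nat_mul, mul_comm] using ((hasDerivAt_id x).const_mul (k : ℝ)).exp
      refine ((hpow.const_mul (Nat.stirlingSecond m k : ℝ)).mul
        (hgk.comp x (Real.hasDerivAt_exp x))).congr_deriv ?_
      simp only [Function.comp_apply]
      ring
    rw [iteratedDeriv_succ, funext ih,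
      (HasDerivAt.fun_sum fun k (_ : k ∈ Finset.range (m + 1)) => hterm k).deriv,
      Finset.sum_add_distrib, Finset.sum_range_succ' _ (m + 1)]
    have hshift : ∑ k ∈ Finset.range (m + 1),
          (k * Nat.stirlingSecond m k * Real.exp x ^ k * iteratedDeriv k g (Real.exp x) : ℝ) =
        ∑ k ∈ Finset.range (m + 1), ((k + 1 : ℕ) * Nat.stirlingSecond m (k + 1) *
          Real.exp x ^ (k + 1) * iteratedDeriv (k + 1) g (Real.exp x) : ℝ) := by
      have h := Finset.sum_range_succ' (fun k : ℕ =>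
        (k * Nat.stirlingSecond m k * Real.exp x ^ k * iteratedDeriv k g (Real.exp x) : ℝ)) (m + 1)
      rw [Finset.sum_range_succ, Nat.stirlingSecond_eq_zero_of_lt (Nat.lt_succ_self m)] at h
      simpa using h
    rw [hshift, ← Finset.sum_add_distrib, Nat.stirlingSecond_succ_zero]
    simp only [Nat.cast_zero, zero_mul, add_zero]
    refine Finset.sum_congr rfl fun k _ => ?_
    rw [Nat.stirlingSecond_succ_succ]
    push_cast
    ring

/-- The partial sum `j_i + ⋯ + j_N` of a tuple whose entries are numbered from `1`. -/
def tailSum {N : ℕ} (j : Fin N → ℕ) (i : ℕ) : ℕ :=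
  ∑ k ∈ Finset.univ.filter (fun k : Fin N => i ≤ (k : ℕ) + 1), j k

theorem tailSum_one {N : ℕ} (j : Fin N → ℕ) : tailSum j 1 = ∑ k, j k := by
  simp [tailSum]

theorem tailSum_cons_succ {N : ℕ} (a : ℕ) (j : Fin N → ℕ) {i : ℕ} (hi : 1 ≤ i) :
    tailSum (Fin.cons a j : Fin (N + 1) → ℕ) (i + 1) = tailSum j i := by
  simp [tailSum, Finset.sum_filter, Fin.sum_univ_succ, Nat.one_le_iff_ne_zero.1 hi]

theorem contDiff_iterate_exp {n : WithTop ℕ∞} (N : ℕ) : ContDiff ℝ n (Real.exp^[N]) := by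
  induction N with
  | zero => exact contDiff_id
  | succ N ih => exact ih.comp Real.contDiff_exp

theorem sum_antidiagonalTuple_succ {M : Type*} [AddCommMonoid M] (N m : ℕ)
    (f : (Fin (N + 1) → ℕ) → M) :
    ∑ j ∈ Finset.Nat.antidiagonalTuple (N + 1) m, f j =
      ∑ k ∈ Finset.range (m + 1), ∑ j ∈ Finset.Nat.antidiagonalTuple N k,
        f (Fin.cons (m - k) j) := by
  rw [Finset.sum_sigma']
  refine Finset.sum_bij' (fun j _ => ⟨∑ k, Fin.tail j k, Fin.tail j⟩)
    (fun p _ => Fin.cons (m - p.1) p.2) ?_ ?_ ?_ ?_ ?_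
  · intro j hj
    rw [Finset.Nat.mem_antidiagonalTuple, Fin.sum_univ_succ] at hj
    simp only [Finset.mem_sigma, Finset.mem_range, Finset.Nat.mem_antidiagonalTuple, and_true,
      Fin.tail]
    omega
  · rintro ⟨k, j⟩ hp
    simp only [Finset.mem_sigma, Finset.mem_range, Finset.Nat.mem_antidiagonalTuple] at hp
    simp only [Finset.Nat.mem_antidiagonalTuple, Fin.sum_univ_succ, Fin.cons_zero, Fin.cons_succ]
    omega
  · intro j hj
    rw [Finset.Nat.mem_antidiagonalTuple, Fin.sum_univ_succ] at hj
    have h : m - ∑ k, Fin.tail j k = j 0 := by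
      simp only [Fin.tail]
      omega
    simp only [h, Fin.cons_self_tail]
  · rintro ⟨k, j⟩ hp
    simp only [Finset.mem_sigma, Finset.mem_range, Finset.Nat.mem_antidiagonalTuple] at hp
    obtain ⟨-, rfl⟩ := hp
    simp
  · intro j hj
    rw [Finset.Nat.mem_antidiagonalTuple, Fin.sum_univ_succ] at hj
    have h : m - ∑ k, Fin.tail j k = j 0 := by
      simp only [Fin.tail]
      omega
    simp only [h, Fin.cons_self_tail]

open scoped ContDiff in
theorem contDiff_iteratedExp_rpow {N : ℕ} (hN : 1 ≤ N) (r : ℝ) :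
    ContDiff ℝ ∞ (fun t : ℝ => (Real.exp^[N] t) ^ r) := by
  refine (contDiff_iterate_exp N).rpow_const_of_ne fun t => ?_
  obtain ⟨n, rfl⟩ := Nat.exists_eq_add_of_le' hN
  rw [Function.iterate_succ_apply']
  exact (Real.exp_pos _).ne'

/-- Expansion of the iterated exponential, first method: for `N ≥ 1`,
`(d/dx)^m (exp^[N] x)^r = Σ_{j₁+⋯+j_N = m} r^{j_N}
(∏_{i=1}^{N−1} S(α_i, α_{i+1})) (exp^[N] x)^r ∏_{i=1}^{N−1} (exp^[i] x)^{α_{i+1}}`,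
where `α_i = j_i + ⋯ + j_N` (so `α_N = j_N`; the tuple `(j₁,…,j_N)` is encoded as a
function `Fin N → ℕ`, index `k` corresponding to `j_{k+1}`). -/
theorem iteratedDeriv_iteratedExp_rpow (N : ℕ) (hN : 1 ≤ N) (r : ℝ) (m : ℕ) (x : ℝ) :
    iteratedDeriv m (fun t : ℝ => (Real.exp^[N] t) ^ r) x =
      ∑ j ∈ Finset.Nat.antidiagonalTuple N m,
        (fun α : ℕ → ℕ =>
            r ^ (α N) *
              (∏ i ∈ Finset.Ico 1 N, (stirlingSecond (α i) (α (i + 1)) : ℝ)) *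
              (Real.exp^[N] x) ^ r *
              ∏ i ∈ Finset.Ico 1 N, (Real.exp^[i] x) ^ ((α (i + 1) : ℝ)))
          (fun i => ∑ k ∈ Finset.univ.filter (fun k : Fin N => i ≤ (k : ℕ) + 1), j k) := by
  change _ = ∑ j ∈ Finset.Nat.antidiagonalTuple N m,
    r ^ (tailSum j N) *
      (∏ i ∈ Finset.Ico 1 N, (stirlingSecond (tailSum j i) (tailSum j (i + 1)) : ℝ)) *
      (Real.exp^[N] x) ^ r *
      ∏ i ∈ Finset.Ico 1 N, (Real.exp^[i] x) ^ ((tailSum j (i + 1) : ℝ))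
  simp only [Real.rpow_natCast, stirlingSecond_eq_natStirlingSecond]
  induction N, hN using Nat.le_induction generalizing m x with
  | base =>
    simp only [Finset.Nat.antidiagonalTuple_one, Finset.sum_singleton, tailSum_one]
    simp [← Real.exp_mul, mul_comm _ r, iteratedDeriv_exp_const_mul]
  | succ N hN ih =>
    simp only [Function.iterate_succ_apply]
    rw [iteratedDeriv_comp_exp (contDiff_iteratedExp_rpow hN r), sum_antidiagonalTuple_succ]
    refine Finset.sum_congr rfl fun k hk => ?_
    rw [ih, Finset.mul_sum]
    refine Finset.sum_congr rfl fun j hj => ?_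
    have hk' : k ≤ m := Nat.lt_succ_iff.1 (Finset.mem_range.1 hk)
    have hj' : ∑ i, j i = k := Finset.Nat.mem_antidiagonalTuple.1 hj
    have hone : tailSum (Fin.cons (m - k) j : Fin (N + 1) → ℕ) 1 = m := by
      rw [tailSum_one, Fin.sum_cons, hj', Nat.sub_add_cancel hk']
    have htwo : tailSum (Fin.cons (m - k) j : Fin (N + 1) → ℕ) 2 = k := by
      rw [tailSum_cons_succ _ _ le_rfl, tailSum_one, hj']
    have hprod (f g : ℕ → ℝ) (hfg : ∀ i, 1 ≤ i → g (i + 1) = f i) :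
        ∏ i ∈ Finset.Ico 1 (N + 1), g i = g 1 * ∏ i ∈ Finset.Ico 1 N, f i := by
      rw [Finset.prod_eq_prod_Ico_succ_bot (by omega), ← Finset.prod_Ico_add' g 1 N 1]
      exact congrArg _ (Finset.prod_congr rfl fun i hi => hfg i (Finset.mem_Ico.1 hi).1)
    rw [hprod (fun i => (Nat.stirlingSecond (tailSum j i) (tailSum j (i + 1)) : ℝ)) _
        fun i hi => by rw [tailSum_cons_succ _ _ hi, tailSum_cons_succ _ _ (by omega)],
      hprod (fun i => Real.exp^[i] (Real.exp x) ^ tailSum j (i + 1)) _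
        fun i hi => by rw [tailSum_cons_succ _ _ (by omega), Function.iterate_succ_apply],
      tailSum_cons_succ _ _ hN, hone, htwo, Function.iterate_one]
    ring
end

section
/- Let N ≥ 1, let r be a real number, let m ≥ 0, and let x be a real number with log^[N](x) > 0, where log^[N] denotes the N-fold iterate of the real logarithm. Then the m-th derivative at x of the function t ↦ (log^[N] t)^r (real power) equals Σ C(r, s_N) · s_N! · (−1)^{m − s_N} · (∏_{i=0}^{N−1} c₂(s_i, s_{i+1})) · (log^[N] x)^{r − s_N} · (∏_{i=1}^{N−1} (log^[i] x)^{−s_i}) · x^{−m}, where the sum is over all chains of natural numbers 0 ≤ s_N ≤ s_{N−1} ≤ ⋯ ≤ s_1 ≤ s_0 with s_0 = m. -/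
/-- The composition formula for the signless Stirling number of the first kind:
`c₂(m,n) = (m!/n!) · Σ 1/(i₁⋯iₙ)`, the sum being over all `n`-tuples of positive
integers with `i₁ + ⋯ + iₙ = m`. -/
noncomputable def stirlingFirstComp (m n : ℕ) : ℝ :=
  (m.factorial : ℝ) / (n.factorial : ℝ) *
    ∑ f ∈ (Finset.Nat.antidiagonalTuple n m).filter (fun f => ∀ i, 0 < f i),
      ∏ i, (1 / (f i : ℝ))

/-- The power series `∑ zⁱ / i = -log (1 - z)`. -/
noncomputable def negLogOneSub : PowerSeries ℝ := PowerSeries.mk fun n => 1 / (n : ℝ)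

theorem coeff_pow_eq_sum_antidiagonalTuple {R : Type*} [CommSemiring R] (P : PowerSeries R)
    (m n : ℕ) :
    PowerSeries.coeff m (P ^ n) =
      ∑ f ∈ Finset.Nat.antidiagonalTuple n m, ∏ i, PowerSeries.coeff (f i) P := by
  have h : P ^ n = ∏ _i : Fin n, P := by simp
  rw [h, PowerSeries.coeff_prod]
  refine Finset.sum_nbij' (fun f => ⇑f) Finsupp.equivFunOnFinite.symm ?_ ?_ ?_ ?_ ?_
  · intro f hf
    simpa [Finset.Nat.mem_antidiagonalTuple] using hf
  · intro f hf
    simpa [Finset.Nat.mem_antidiagonalTuple] using hf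
  · intro f _
    ext
    simp
  · intro f _
    ext
    simp
  · intro f _
    simp

theorem stirlingFirstComp_eq_coeff (m n : ℕ) :
    stirlingFirstComp m n =
      (m.factorial : ℝ) / (n.factorial : ℝ) * PowerSeries.coeff m (negLogOneSub ^ n) := by
  rw [stirlingFirstComp, coeff_pow_eq_sum_antidiagonalTuple]
  congr 1
  rw [Finset.sum_filter]
  refine Finset.sum_congr rfl fun f _ => ?_
  simp only [negLogOneSub, PowerSeries.coeff_mk]
  split_ifs with h
  · rfl
  · push Not at h
    obtain ⟨i, hi⟩ := h
    exact (Finset.prod_eq_zero (Finset.mem_univ i) (by simp [Nat.le_zero.mp hi])).symm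

theorem stirlingFirstComp_eq_zero_of_lt {m n : ℕ} (h : m < n) : stirlingFirstComp m n = 0 := by
  rw [stirlingFirstComp, Finset.filter_false_of_mem, Finset.sum_empty, mul_zero]
  intro f hf hpos
  rw [Finset.Nat.mem_antidiagonalTuple] at hf
  have : ∑ _i : Fin n, 1 ≤ ∑ i, f i := Finset.sum_le_sum fun i _ => hpos i
  simp at this
  omega

theorem stirlingFirstComp_zero_zero : stirlingFirstComp 0 0 = 1 := by
  simp [stirlingFirstComp_eq_coeff]

theorem stirlingFirstComp_succ_zero (m : ℕ) : stirlingFirstComp (m + 1) 0 = 0 := by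
  simp [stirlingFirstComp_eq_coeff, PowerSeries.coeff_one]

theorem one_sub_X_mul_derivative_negLogOneSub :
    (1 - PowerSeries.X) * PowerSeries.derivative ℝ negLogOneSub = 1 := by
  have h : PowerSeries.derivative ℝ negLogOneSub = PowerSeries.mk 1 := by
    ext n
    have : (n : ℝ) + 1 ≠ 0 := by positivity
    simp [PowerSeries.coeff_derivative, negLogOneSub, this]
  rw [h, mul_comm, PowerSeries.mk_one_mul_one_sub_eq_one]

theorem coeff_negLogOneSub_pow_recurrence (m n : ℕ) :
    PowerSeries.coeff (m + 1) (negLogOneSub ^ (n + 1)) * (m + 1) =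
      (n + 1) * PowerSeries.coeff m (negLogOneSub ^ n) +
        m * PowerSeries.coeff m (negLogOneSub ^ (n + 1)) := by
  have h : PowerSeries.derivative ℝ (negLogOneSub ^ (n + 1)) =
      ((n + 1 : ℕ) : PowerSeries ℝ) * negLogOneSub ^ n +
        PowerSeries.X * PowerSeries.derivative ℝ (negLogOneSub ^ (n + 1)) := by
    rw [PowerSeries.derivative_pow]
    simp only [Nat.add_sub_cancel]
    linear_combination ((n + 1 : ℕ) : PowerSeries ℝ) * negLogOneSub ^ n *
      one_sub_X_mul_derivative_negLogOneSub
  have h' := congrArg (PowerSeries.coeff m) h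
  rw [map_add, PowerSeries.coeff_derivative, ← nsmul_eq_mul, map_nsmul, nsmul_eq_mul] at h'
  rw [h']
  cases m with
  | zero => simp
  | succ m =>
    rw [PowerSeries.coeff_succ_X_mul, PowerSeries.coeff_derivative]
    push_cast
    ring

theorem stirlingFirstComp_succ_succ (m n : ℕ) :
    stirlingFirstComp (m + 1) (n + 1) =
      stirlingFirstComp m n + m * stirlingFirstComp m (n + 1) := by
  have h := coeff_negLogOneSub_pow_recurrence m n
  simp only [stirlingFirstComp_eq_coeff, Nat.factorial_succ]
  have hn : (n.factorial : ℝ) ≠ 0 := by positivity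
  have hn' : (n : ℝ) + 1 ≠ 0 := by positivity
  push_cast
  field_simp
  linear_combination h

/-- The candidate for the `m`-th derivative of `t ↦ (log^[N] t) ^ r`, obtained by differentiating
one logarithm at a time. -/
noncomputable def iterLogRpowDeriv (r : ℝ) : ℕ → ℕ → ℝ → ℝ
  | 0, m, y => (∏ i ∈ Finset.range m, (r - i)) * y ^ (r - m)
  | N + 1, m, y => y⁻¹ ^ m * ∑ k ∈ Finset.range (m + 1),
      stirlingFirstComp m k * (-1) ^ (m + k) * iterLogRpowDeriv r N k (Real.log y)

theorem ne_zero_of_iterate_log_pos {N : ℕ} {y : ℝ} (h : 0 < Real.log^[N] y) : y ≠ 0 := by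
  rintro rfl
  rw [Function.iterate_fixed Real.log_zero] at h
  exact h.false

theorem sum_stirlingFirstComp_succ (m : ℕ) (g : ℕ → ℝ) :
    ∑ k ∈ Finset.range (m + 2), stirlingFirstComp (m + 1) k * (-1) ^ (m + 1 + k) * g k =
      ∑ k ∈ Finset.range (m + 1), stirlingFirstComp m k * (-1) ^ (m + k) * g (k + 1) -
        m * ∑ k ∈ Finset.range (m + 1), stirlingFirstComp m k * (-1) ^ (m + k) * g k := by
  have h : (m : ℝ) * ∑ k ∈ Finset.range (m + 1), stirlingFirstComp m k * (-1) ^ (m + k) * g k =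
      m * ∑ k ∈ Finset.range (m + 1),
        stirlingFirstComp m (k + 1) * (-1) ^ (m + (k + 1)) * g (k + 1) := by
    have h0 : (m : ℝ) * stirlingFirstComp m 0 = 0 := by
      cases m <;> simp [stirlingFirstComp_succ_zero]
    have h1 := Finset.sum_range_succ
      (fun k => stirlingFirstComp m k * (-1) ^ (m + k) * g k) (m + 1)
    rw [Finset.sum_range_succ' _ (m + 1), stirlingFirstComp_eq_zero_of_lt (Nat.lt_succ_self m)] at h1
    linear_combination (-(m : ℝ)) * h1 + (-1) ^ m * g 0 * h0
  rw [h, Finset.sum_range_succ', stirlingFirstComp_succ_zero, Finset.mul_sum,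
    ← Finset.sum_sub_distrib, zero_mul, zero_mul, add_zero]
  refine Finset.sum_congr rfl fun k _ => ?_
  rw [stirlingFirstComp_succ_succ]
  ring

theorem hasDerivAt_iterLogRpowDeriv (r : ℝ) (N m : ℕ) {y : ℝ} (hy : 0 < Real.log^[N] y) :
    HasDerivAt (iterLogRpowDeriv r N m) (iterLogRpowDeriv r N (m + 1) y) y := by
  induction N generalizing m y with
  | zero =>
    rw [Function.iterate_zero_apply] at hy
    have h := (Real.hasDerivAt_rpow_const (p := r - m) (Or.inl hy.ne')).const_mul
      (∏ i ∈ Finset.range m, (r - i))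
    refine h.congr_deriv ?_
    rw [iterLogRpowDeriv, Finset.prod_range_succ, Nat.cast_succ, sub_sub, mul_assoc]
  | succ N ih =>
    have hy0 := ne_zero_of_iterate_log_pos hy
    rw [Function.iterate_succ_apply] at hy
    have hsum : HasDerivAt (fun y => ∑ k ∈ Finset.range (m + 1),
        stirlingFirstComp m k * (-1) ^ (m + k) * iterLogRpowDeriv r N k (Real.log y)) _ y :=
      HasDerivAt.fun_sum fun k _ =>
        ((ih k hy).comp y (Real.hasDerivAt_log hy0)).const_mul
          (stirlingFirstComp m k * (-1) ^ (m + k))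
    refine (((hasDerivAt_inv hy0).fun_pow m).mul hsum).congr_deriv ?_
    rw [iterLogRpowDeriv, sum_stirlingFirstComp_succ]
    simp only [← mul_assoc]
    rw [← Finset.sum_mul]
    cases m with
    | zero => simp [mul_comm]
    | succ m =>
      rw [Nat.add_sub_cancel]
      ring

theorem continuousAt_iterate_log {N : ℕ} {y : ℝ} (hy : 0 < Real.log^[N] y) :
    ContinuousAt Real.log^[N] y := by
  induction N generalizing y with
  | zero => exact continuousAt_id
  | succ N ih =>
    have hy0 := ne_zero_of_iterate_log_pos hy
    rw [Function.iterate_succ_apply] at hy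
    exact (ih hy).comp (Real.continuousAt_log hy0)

theorem iterLogRpowDeriv_zero (r : ℝ) (N : ℕ) (y : ℝ) :
    iterLogRpowDeriv r N 0 y = (Real.log^[N] y) ^ r := by
  induction N generalizing y with
  | zero => simp [iterLogRpowDeriv]
  | succ N ih => simp [iterLogRpowDeriv, stirlingFirstComp_zero_zero, ih]

theorem iteratedDeriv_eq_iterLogRpowDeriv (r : ℝ) (N m : ℕ) {y : ℝ} (hy : 0 < Real.log^[N] y) :
    iteratedDeriv m (fun t : ℝ => (Real.log^[N] t) ^ r) y = iterLogRpowDeriv r N m y := by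
  induction m generalizing y with
  | zero => rw [iteratedDeriv_zero, iterLogRpowDeriv_zero]
  | succ m ih =>
    have hev : iteratedDeriv m (fun t : ℝ => (Real.log^[N] t) ^ r) =ᶠ[nhds y]
        iterLogRpowDeriv r N m := by
      filter_upwards [(continuousAt_iterate_log hy).eventually (lt_mem_nhds hy)] with z hz
      exact ih hz
    rw [iteratedDeriv_succ, hev.deriv_eq, (hasDerivAt_iterLogRpowDeriv r N m hy).deriv]

/-- The contribution of the chain `S 0, …, S N` to `iterLogRpowDeriv r N (S 0) y`. -/
noncomputable def chainTerm (r : ℝ) (N : ℕ) (y : ℝ) (S : ℕ → ℕ) : ℝ :=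
  (∏ i ∈ Finset.range (S N), (r - i)) * (-1) ^ (S 0 + S N) *
    (∏ i ∈ Finset.range N, stirlingFirstComp (S i) (S (i + 1))) *
    (Real.log^[N] y) ^ (r - S N) *
    ∏ i ∈ Finset.range N, (Real.log^[i] y)⁻¹ ^ S i

/-- Extension of a tuple by zero to a sequence. -/
def tupleExtend {n M : ℕ} (s : Fin n → Fin M) (i : ℕ) : ℕ := if h : i < n then (s ⟨i, h⟩ : ℕ) else 0

theorem chainTerm_succ (r : ℝ) (N : ℕ) (y : ℝ) (S : ℕ → ℕ) :
    chainTerm r (N + 1) y S = y⁻¹ ^ S 0 * (stirlingFirstComp (S 0) (S 1) * (-1) ^ (S 0 + S 1) *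
      chainTerm r N (Real.log y) fun i => S (i + 1)) := by
  have h : ((-1 : ℝ)) ^ S 1 * (-1) ^ S 1 = 1 := by rw [← mul_pow]; simp
  simp only [chainTerm, Finset.prod_range_succ' _ N, Function.iterate_succ_apply,
    Function.iterate_zero, id_eq, zero_add, pow_add]
  linear_combination (-(∏ i ∈ Finset.range (S (N + 1)), (r - i)) * (-1) ^ S 0 * (-1) ^ S (N + 1) *
    (∏ i ∈ Finset.range N, stirlingFirstComp (S (i + 1)) (S (i + 1 + 1))) *
    stirlingFirstComp (S 0) (S 1) * (Real.log^[N] (Real.log y)) ^ (r - S (N + 1)) *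
    (∏ i ∈ Finset.range N, (Real.log^[i] (Real.log y))⁻¹ ^ S (i + 1)) * y⁻¹ ^ S 0) * h

theorem sum_chainTerm (r : ℝ) (N : ℕ) {M m : ℕ} (hm : m < M) (y : ℝ) :
    ∑ s : Fin (N + 1) → Fin M, (if (s 0 : ℕ) = m then chainTerm r N y (tupleExtend s) else 0) =
      iterLogRpowDeriv r N m y := by
  induction N generalizing m y with
  | zero =>
    rw [Finset.sum_eq_single fun _ => (⟨m, hm⟩ : Fin M)]
    · simp [chainTerm, tupleExtend, iterLogRpowDeriv, ← two_mul]
    · intro s _ hs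
      refine if_neg fun h => hs ?_
      ext i
      rw [Fin.fin_one_eq_zero i]
      exact h
    · simp
  | succ N ih =>
    rw [← (Fin.consEquiv fun _ => Fin M).sum_comp, Fintype.sum_prod_type,
      Finset.sum_eq_single (⟨m, hm⟩ : Fin M)]
    · have hterm (t : Fin (N + 1) → Fin M) :
          chainTerm r (N + 1) y (tupleExtend (Fin.cons (⟨m, hm⟩ : Fin M) t)) =
            ∑ k ∈ Finset.range M, y⁻¹ ^ m * (stirlingFirstComp m k * (-1) ^ (m + k) *
              (if (t 0 : ℕ) = k then chainTerm r N (Real.log y) (tupleExtend t) else 0)) := by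
        have h0 : tupleExtend (Fin.cons (⟨m, hm⟩ : Fin M) t : Fin (N + 2) → Fin M) 0 = m := by
          simp [tupleExtend]
        have h1 (i : ℕ) : tupleExtend (Fin.cons (⟨m, hm⟩ : Fin M) t : Fin (N + 2) → Fin M) (i + 1) =
            tupleExtend t i := by
          simp only [tupleExtend, Nat.add_lt_add_iff_right]
          rfl
        rw [chainTerm_succ, h0, h1 0, Finset.sum_eq_single (t 0 : ℕ)]
        · rw [if_pos rfl, funext h1]
          simp [tupleExtend]
        · intro k _ hk
          simp [hk.symm]
        · simp
      simp only [Fin.consEquiv, Equiv.coe_fn_mk, Fin.cons_zero, if_true, hterm]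
      rw [Finset.sum_comm]
      simp only [← Finset.mul_sum]
      rw [iterLogRpowDeriv]
      congr 1
      rw [← Finset.sum_subset (Finset.range_subset_range.mpr hm)]
      · refine Finset.sum_congr rfl fun k hk => ?_
        rw [ih (by rw [Finset.mem_range] at hk; omega)]
      · intro k _ hk
        rw [stirlingFirstComp_eq_zero_of_lt (by rw [Finset.mem_range] at hk; omega)]
        simp
    · intro a _ ha
      refine Finset.sum_eq_zero fun t _ => if_neg fun h => ha (Fin.ext ?_)
      simpa [Fin.consEquiv] using h
    · simp

theorem antitone_of_chainTerm_ne_zero {r y : ℝ} {N M : ℕ} {s : Fin (N + 1) → Fin M}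
    (h : chainTerm r N y (tupleExtend s) ≠ 0) : Antitone s := by
  rw [Fin.antitone_iff_succ_le]
  intro i
  by_contra! hlt
  refine h ?_
  have hprod : ∏ i ∈ Finset.range N,
      stirlingFirstComp (tupleExtend s i) (tupleExtend s (i + 1)) = 0 := by
    refine Finset.prod_eq_zero (Finset.mem_range.mpr i.2) (stirlingFirstComp_eq_zero_of_lt ?_)
    rw [tupleExtend, tupleExtend, dif_pos (by omega), dif_pos (by omega)]
    exact hlt
  simp [chainTerm, hprod]

theorem rpow_neg_natCast_eq_inv_pow (a : ℝ) (n : ℕ) : a ^ (-(n : ℝ)) = a⁻¹ ^ n := by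
  rw [Real.rpow_neg_natCast, zpow_neg, zpow_natCast, inv_pow]

theorem chainTerm_eq (r : ℝ) {N : ℕ} (hN : 1 ≤ N) (y : ℝ) {S : ℕ → ℕ} (h : S N ≤ S 0) :
    chainTerm r N y S =
      ((∏ i ∈ Finset.range (S N), (r - i)) / (S N).factorial) *
        ((S N).factorial : ℝ) *
        (-1) ^ (S 0 - S N) *
        (∏ i ∈ Finset.range N, stirlingFirstComp (S i) (S (i + 1))) *
        (Real.log^[N] y) ^ (r - S N) *
        (∏ i ∈ Finset.Ico 1 N, (Real.log^[i] y) ^ (-(S i : ℝ))) *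
        y ^ (-(S 0 : ℝ)) := by
  have hsign : (-1 : ℝ) ^ (S 0 + S N) = (-1) ^ (S 0 - S N) := by
    obtain ⟨d, hd⟩ := Nat.exists_eq_add_of_le h
    rw [hd, Nat.add_sub_cancel_left, add_right_comm, ← two_mul, pow_add, pow_mul]
    simp
  simp only [rpow_neg_natCast_eq_inv_pow]
  rw [chainTerm, hsign, div_mul_cancel₀ _ (by positivity), Finset.prod_range_eq_mul_Ico _ hN,
    Finset.prod_range_eq_mul_Ico (fun i => (Real.log^[i] y)⁻¹ ^ S i) hN,
    Function.iterate_zero, id_eq]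
  ring

/-- Expansion of the iterated logarithm, second method: for `N ≥ 1` and
`log^[N] x > 0`, `(d/dx)^m (log^[N] x)^r` equals the sum over all chains
`m = s₀ ≥ s₁ ≥ ⋯ ≥ s_N ≥ 0` (encoded as antitone functions
`Fin (N+1) → Fin (m+1)` with value `m` at `0`) of
`C(r,s_N) s_N! (−1)^{m−s_N} (∏_{i=0}^{N−1} c₂(s_i, s_{i+1}))
(log^[N] x)^{r−s_N} (∏_{i=1}^{N−1} (log^[i] x)^{−s_i}) x^{−m}`. -/
theorem iteratedDeriv_iteratedLog_rpow_second (N : ℕ) (hN : 1 ≤ N) (r : ℝ) (m : ℕ)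
    (x : ℝ) (hx : 0 < Real.log^[N] x) :
    iteratedDeriv m (fun t : ℝ => (Real.log^[N] t) ^ r) x =
      ∑ s ∈ Finset.univ.filter
          (fun s : Fin (N + 1) → Fin (m + 1) =>
            (s 0 : ℕ) = m ∧ ∀ i j, i ≤ j → s j ≤ s i),
        (fun S : ℕ → ℕ =>
            ((∏ i ∈ Finset.range (S N), (r - i)) / (S N).factorial) *
              ((S N).factorial : ℝ) *
              (-1) ^ (m - S N) *
              (∏ i ∈ Finset.range N, stirlingFirstComp (S i) (S (i + 1))) *
              (Real.log^[N] x) ^ (r - S N) *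
              (∏ i ∈ Finset.Ico 1 N, (Real.log^[i] x) ^ (-(S i : ℝ))) *
              x ^ (-(m : ℝ)))
          (fun i => if h : i < N + 1 then (s ⟨i, h⟩ : ℕ) else 0) := by
  rw [iteratedDeriv_eq_iterLogRpowDeriv r N m hx, ← sum_chainTerm r N (Nat.lt_succ_self m) x,
    ← Finset.sum_filter]
  symm
  refine Finset.sum_subset_zero_on_sdiff
    (Finset.monotone_filter_right _ fun s _ hs => hs.1) (fun s hs => ?_) fun s hs => ?_
  · simp only [Finset.mem_sdiff, Finset.mem_filter, Finset.mem_univ, true_and, not_and] at hs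
    by_contra hne
    exact hs.2 hs.1 fun i j hij => antitone_of_chainTerm_ne_zero hne hij
  · obtain ⟨h0, hanti⟩ := (Finset.mem_filter.mp hs).2
    have hS0 : tupleExtend s 0 = m := by simpa [tupleExtend] using h0
    have hle : tupleExtend s N ≤ tupleExtend s 0 := by
      rw [tupleExtend, tupleExtend, dif_pos (Nat.lt_succ_self N), dif_pos (Nat.succ_pos N)]
      exact hanti 0 (Fin.last N) (Fin.zero_le _)
    rw [chainTerm_eq r hN x hle, hS0]
    rfl
end

section
/- Fix a real number s, and let M : ℕ → ℕ → ℝ be any function satisfying M(m,j) = (m−1−s)·M(m−1,j) + M(m−1,j−1) for all 1 ≤ j < m, together with M(m,0) = ∏_{t=0}^{m−1}(t−s) for all m > 0 and M(m,m) = 1 for all m ≥ 0. Then for every real r, every real x > 1, and every m ≥ 0, the m-th derivative at x of the function t ↦ t^s · (log t)^r (real powers) equals Σ_{j=0}^{m} (∏_{i=0}^{j−1}(r−i)) · (−1)^{m−j} · M(m,j) · x^{s−m} · (log x)^{r−j}. -/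
/-- A term `c t^a (log t)^b` differentiates to two terms of the same shape on `(1, ∞)`. -/
theorem hasDerivAt_const_mul_rpow_mul_log_rpow (c a b : ℝ) {x : ℝ} (hx : 1 < x) :
    HasDerivAt (fun t : ℝ => c * t ^ a * Real.log t ^ b)
      (c * a * x ^ (a - 1) * Real.log x ^ b + c * b * x ^ (a - 1) * Real.log x ^ (b - 1)) x := by
  have hx0 : 0 < x := by linarith
  have hlog : Real.log x ≠ 0 := (Real.log_pos hx).ne'
  have hpow : HasDerivAt (fun t : ℝ => t ^ a) (a * x ^ (a - 1)) x :=
    Real.hasDerivAt_rpow_const (Or.inl hx0.ne')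
  have hlogpow : HasDerivAt (fun t : ℝ => Real.log t ^ b)
      (x⁻¹ * b * Real.log x ^ (b - 1)) x :=
    (Real.hasDerivAt_log hx0.ne').rpow_const (Or.inl hlog)
  refine ((hpow.const_mul c).mul hlogpow).congr_deriv ?_
  rw [Real.rpow_sub_one hx0.ne']
  ring

/-- The coefficient recurrence is exactly what differentiating the expansion once requires. -/
theorem sum_deriv_terms_eq_sum_succ (s : ℝ) (M : ℕ → ℕ → ℝ)
    (hrec : ∀ m j : ℕ, 1 ≤ j → j < m →
      M m j = ((m : ℝ) - 1 - s) * M (m - 1) j + M (m - 1) (j - 1))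
    (hzero : ∀ m : ℕ, 0 < m → M m 0 = ∏ t ∈ Finset.range m, ((t : ℝ) - s))
    (hdiag : ∀ m : ℕ, M m m = 1) (r : ℝ) (m : ℕ) (y : ℝ) (L : ℝ → ℝ) :
    ∑ j ∈ Finset.range (m + 1),
        ((∏ i ∈ Finset.range j, (r - i)) * (-1) ^ (m - j) * M m j * (s - m) * y * L (r - j) +
          (∏ i ∈ Finset.range j, (r - i)) * (-1) ^ (m - j) * M m j * (r - j) * y *
            L (r - j - 1)) =
      ∑ j ∈ Finset.range (m + 1 + 1),
        (∏ i ∈ Finset.range j, (r - i)) * (-1) ^ (m + 1 - j) * M (m + 1) j * y * L (r - j) := by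
  have hcol : M (m + 1) 0 = ((m : ℝ) - s) * M m 0 := by
    rw [hzero (m + 1) m.succ_pos, Finset.prod_range_succ, mul_comm]
    rcases Nat.eq_zero_or_pos m with rfl | hm
    · simp [hdiag]
    · rw [hzero m hm]
  have hL (j : ℕ) : L (r - (j + 1 : ℕ)) = L (r - j - 1) := by
    congr 1
    push_cast
    ring
  rw [Finset.sum_add_distrib, Finset.sum_range_succ' _ m, Finset.sum_range_succ _ m,
    Finset.sum_range_succ' _ (m + 1), Finset.sum_range_succ _ m]
  have hinner : ∀ j ∈ Finset.range m,
      (∏ i ∈ Finset.range (j + 1), (r - i)) * (-1) ^ (m + 1 - (j + 1)) * M (m + 1) (j + 1) * y *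
          L (r - (j + 1 : ℕ)) =
        (∏ i ∈ Finset.range (j + 1), (r - i)) * (-1) ^ (m - (j + 1)) * M m (j + 1) * (s - m) * y *
            L (r - (j + 1 : ℕ)) +
          (∏ i ∈ Finset.range j, (r - i)) * (-1) ^ (m - j) * M m j * (r - j) * y *
            L (r - j - 1) := by
    intro j hj
    obtain ⟨k, rfl⟩ := Nat.exists_eq_add_of_lt (Finset.mem_range.mp hj)
    have hk : j + k + 1 - j = k + 1 := by omega
    rw [hrec (j + k + 1 + 1) (j + 1) (by omega) (by omega), hL, Finset.prod_range_succ,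
      Nat.add_sub_cancel, Nat.add_sub_cancel, Nat.add_sub_add_right, Nat.add_sub_add_right, hk,
      Nat.add_sub_cancel_left, pow_succ]
    push_cast
    ring
  rw [Finset.sum_congr rfl hinner, Finset.sum_add_distrib, hL, hcol, hdiag, hdiag,
    Finset.prod_range_succ]
  simp only [Nat.sub_self, Nat.sub_zero, pow_zero, pow_succ, Finset.range_zero, Finset.prod_empty]
  ring

/-- Fix `s : ℝ`. Any solution `M` of the recurrence
`M(m,j) = (m−1−s)·M(m−1,j) + M(m−1,j−1)` (for `1 ≤ j < m`), with
`M(m,0) = ∏_{t=0}^{m−1}(t−s)` for `m > 0` and `M(m,m) = 1`, gives the expansion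
coefficients of `(x+y)^s (log(x+y))^r`:
`(d/dx)^m (x^s (log x)^r) = Σ_{j=0}^{m} r(r−1)⋯(r−j+1) (−1)^{m−j} M(m,j)
x^{s−m} (log x)^{r−j}`. -/
theorem iteratedDeriv_rpow_mul_log_rpow_of_recurrence (s : ℝ) (M : ℕ → ℕ → ℝ)
    (hrec : ∀ m j : ℕ, 1 ≤ j → j < m →
      M m j = ((m : ℝ) - 1 - s) * M (m - 1) j + M (m - 1) (j - 1))
    (hzero : ∀ m : ℕ, 0 < m → M m 0 = ∏ t ∈ Finset.range m, ((t : ℝ) - s))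
    (hdiag : ∀ m : ℕ, M m m = 1)
    (r : ℝ) (x : ℝ) (hx : 1 < x) (m : ℕ) :
    iteratedDeriv m (fun t : ℝ => t ^ s * Real.log t ^ r) x =
      ∑ j ∈ Finset.range (m + 1),
        (∏ i ∈ Finset.range j, (r - i)) * (-1) ^ (m - j) * M m j *
          x ^ (s - m) * Real.log x ^ (r - j) := by
  induction m generalizing x with
  | zero => simp [hdiag]
  | succ m ih =>
    have heq : iteratedDeriv m (fun t : ℝ => t ^ s * Real.log t ^ r) =ᶠ[nhds x]
        fun t => ∑ j ∈ Finset.range (m + 1),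
          (∏ i ∈ Finset.range j, (r - i)) * (-1) ^ (m - j) * M m j *
            t ^ (s - m) * Real.log t ^ (r - j) := by
      filter_upwards [lt_mem_nhds hx] with t ht using ih t ht
    have hexp : s - (m + 1 : ℕ) = s - m - 1 := by
      push_cast
      ring
    rw [iteratedDeriv_succ, heq.deriv_eq, hexp,
      ← sum_deriv_terms_eq_sum_succ s M hrec hzero hdiag r m _ (Real.log x ^ ·)]
    exact (HasDerivAt.fun_sum fun (j : ℕ) _ =>
      hasDerivAt_const_mul_rpow_mul_log_rpow _ (s - m) (r - j) hx).deriv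
end
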